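/- There is no function f : ℝ → ℝ with f(x) > 0 for all x > 0 that satisfies f(f(x) + y) = f(x) + 3x + y·f(y) for all x > 0 and y > 0. -/

import Mathlib

theorem problem_5 :
    ¬ ∃ f : ℝ → ℝ, (∀ x : ℝ, 0 < x → 0 < f x) ∧
      (∀ x : ℝ, 0 < x → ∀ y : ℝ, 0 < y → f (f x + y) = f x + 3 * x + y * f y) := by
  rintro ⟨f, hpos, hf⟩
  set a := f 1 with ha
  have a_pos : 0 < a := hpos 1 one_pos
  have three_lt : ∀ t, a < t → 3 < f t := by
    intro t ht
    have h := hf 1 one_pos (t - a) (by linarith)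
    rw [← ha, add_sub_cancel] at h
    have := mul_pos (sub_pos.2 ht) (hpos (t - a) (sub_pos.2 ht))
    linarith
  have linear_lt : ∀ t, 2 * a < t → 3 * (t - a) < f t := by
    intro t ht
    have h := hf 1 one_pos (t - a) (by linarith)
    rw [← ha, add_sub_cancel] at h
    have := mul_lt_mul_of_pos_left (three_lt (t - a) (by linarith)) (show 0 < t - a by linarith)
    linarith
  -- Comparing the equation at `(x, f 1)` and `(1, f x)` determines `f x * f (f x)`.
  obtain ⟨c, hc⟩ : ∃ c, ∀ x, 0 < x → f x * f (f x) = f x + 3 * x - c := by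
    refine ⟨a + 3 - a * f a, fun x hx => ?_⟩
    have h₁ := hf x hx a a_pos
    have h₂ := hf 1 one_pos (f x) (hpos x hx)
    rw [← ha, add_comm a (f x)] at h₂
    linarith
  let x := 2 * a + 1 + |c|
  have hx : x = 2 * a + 1 + |c| := rfl
  have hc_abs := abs_nonneg c
  have hc_neg := neg_abs_le c
  have hfx := linear_lt x (by linarith)
  have hffx := three_lt (f x) (by linarith)
  have := mul_lt_mul_of_pos_left hffx (hpos x (by linarith))
  linarith [hc x (by linarith)]
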